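/- Let f : ℝ^d → Set(ℝ^d) satisfy Assumption (f), and let b : ℝ^d → ℝ^d be Lipschitz continuous with constant L_b. Let w ∈ ℝ^d and k ∈ (0,T] with L_b·k < 1. Then there exist a uniquely determined x₀ ∈ D(f) and a uniquely determined η ∈ f(x₀) such that x₀ + k·η − k·b(x₀) = w. -/

import Mathlib

open scoped RealInnerProductSpace NNReal

/-- A set-valued map `f` on `ℝ^d` is maximal monotone: it is monotone, and any pair
`(x, y)` satisfying `⟨y − f_v, x − v⟩ ≥ 0` against all elements of the graph of `f`
belongs to the graph of `f`. -/
def MaxMonotone {d : ℕ}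
    (f : EuclideanSpace ℝ (Fin d) → Set (EuclideanSpace ℝ (Fin d))) : Prop :=
  (∀ u v fu fv, fu ∈ f u → fv ∈ f v → 0 ≤ ⟪fu - fv, u - v⟫) ∧
  (∀ x y, (∀ v fv, fv ∈ f v → 0 ≤ ⟪y - fv, x - v⟫) → y ∈ f x)

/-- Assumption (f): `f` is maximal monotone with nonempty interior of its domain
`D(f) = {x : f x ≠ ∅}`, and satisfies the coercivity bound
`⟨f_v, v⟩ ≥ μ|v|^p − λ` and the growth bound `|f_v| ≤ β(1 + |v|^{p−1})`. -/
def AssumptionF {d : ℕ}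
    (f : EuclideanSpace ℝ (Fin d) → Set (EuclideanSpace ℝ (Fin d)))
    (β lam μ p : ℝ) : Prop :=
  MaxMonotone f ∧
  (interior {x | (f x).Nonempty}).Nonempty ∧
  (∀ v fv, fv ∈ f v → μ * ‖v‖ ^ p - lam ≤ ⟪fv, v⟫ ∧ ‖fv‖ ≤ β * (1 + ‖v‖ ^ (p - 1)))

section MonotoneSets

variable {E : Type*} [NormedAddCommGroup E] [InnerProductSpace ℝ E]

/-- Convex combinations of a monotone family satisfy a Jensen-type inequality for the pairing. -/
lemma inner_sum_le_sum_inner_of_monotone {ι : Type*} [Fintype ι] {g v : ι → E}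
    (hmono : ∀ i j, 0 ≤ ⟪g i - g j, v i - v j⟫) {l : ι → ℝ} (hl : l ∈ stdSimplex ℝ ι) :
    ⟪∑ i, l i • g i, ∑ i, l i • v i⟫ ≤ ∑ i, l i * ⟪g i, v i⟫ := by
  obtain ⟨hl0, hl1⟩ := hl
  set G := ∑ i, l i • g i with hG
  set V := ∑ i, l i • v i with hV
  set S := ∑ i, l i * ⟪g i, v i⟫ with hS
  have hrow : ∀ i, 0 ≤ ⟪g i, v i⟫ - ⟪g i, V⟫ - ⟪G, v i⟫ + S := by
    intro i
    have h : 0 ≤ ∑ j, l j * ⟪g i - g j, v i - v j⟫ :=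
      Finset.sum_nonneg fun j _ => mul_nonneg (hl0 j) (hmono i j)
    have heq : ∑ j, l j * ⟪g i - g j, v i - v j⟫
        = (∑ j, l j) * ⟪g i, v i⟫ - ⟪g i, V⟫ - ⟪G, v i⟫ + S := by
      rw [hG, hV, hS, inner_sum, sum_inner, Finset.sum_mul, ← Finset.sum_sub_distrib,
        ← Finset.sum_sub_distrib, ← Finset.sum_add_distrib]
      refine Finset.sum_congr rfl fun j _ => ?_
      simp only [inner_sub_left, inner_sub_right, real_inner_smul_left, real_inner_smul_right]
      ring
    rwa [heq, hl1, one_mul] at h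
  have h : 0 ≤ ∑ i, l i * (⟪g i, v i⟫ - ⟪g i, V⟫ - ⟪G, v i⟫ + S) :=
    Finset.sum_nonneg fun i _ => mul_nonneg (hl0 i) (hrow i)
  have heq : ∑ i, l i * (⟪g i, v i⟫ - ⟪g i, V⟫ - ⟪G, v i⟫ + S)
      = S - ⟪G, V⟫ - ⟪G, V⟫ + (∑ i, l i) * S := by
    have h1 : ⟪G, V⟫ = ∑ i, l i * ⟪g i, V⟫ := by
      simp only [hG, sum_inner, real_inner_smul_left]
    have h2 : ⟪G, V⟫ = ∑ i, l i * ⟪G, v i⟫ := by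
      simp only [hV, inner_sum, real_inner_smul_right]
    conv_rhs => rw [Finset.sum_mul]
    nth_rewrite 1 [h1]
    rw [h2]
    conv_rhs => enter [1, 1, 1]; rw [hS]
    rw [← Finset.sum_sub_distrib, ← Finset.sum_sub_distrib, ← Finset.sum_add_distrib]
    exact Finset.sum_congr rfl fun i _ => by ring
  rw [heq, hl1] at h
  linarith

/-- Debrunner–Flor: a finite monotone family can be extended by a pair of the form `(x, -x)`. -/
lemma exists_inner_add_sub_nonpos_of_monotone {ι : Type*} [Fintype ι] [Nonempty ι] {g v : ι → E}
    (hmono : ∀ i j, 0 ≤ ⟪g i - g j, v i - v j⟫) :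
    ∃ x, ∀ i, ⟪x + g i, x - v i⟫ ≤ 0 := by
  classical
  let c : (ι → ℝ) → E := fun l => ∑ i, l i • ((1 / 2 : ℝ) • (v i - g i))
  let s : (ι → ℝ) → ℝ := fun l => ∑ i, l i * ⟪g i, v i⟫
  have hcont : Continuous fun l => -⟪c l, c l⟫ - s l := by fun_prop
  obtain ⟨l, hl, hmax⟩ := (isCompact_stdSimplex ℝ ι).exists_isMaxOn
    ⟨_, single_mem_stdSimplex ℝ (Classical.arbitrary ι)⟩ hcont.continuousOn
  refine ⟨c l, fun i => ?_⟩
  have hneg : -⟪c l, c l⟫ - s l ≤ 0 := by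
    have h := inner_sum_le_sum_inner_of_monotone hmono hl
    have hc : c l = (1 / 2 : ℝ) • (∑ i, l i • v i - ∑ i, l i • g i) := by
      simp only [c, ← Finset.sum_sub_distrib, Finset.smul_sum]
      exact Finset.sum_congr rfl fun i _ => by module
    have hsq := real_inner_self_nonneg (x := ∑ i, l i • v i + ∑ i, l i • g i)
    rw [hc]
    simp only [inner_sub_left, inner_sub_right, inner_add_left, inner_add_right,
      real_inner_smul_left, real_inner_smul_right] at hsq ⊢
    rw [real_inner_comm (∑ i, l i • g i) (∑ i, l i • v i)] at *
    simp only [s]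
    linarith
  set ci : E := (1 / 2 : ℝ) • (v i - g i) with hci
  have hdir : ∀ t : ℝ, 0 < t → t ≤ 1 →
      -2 * ⟪c l, ci - c l⟫ - ⟪g i, v i⟫ + s l ≤ t * ⟪ci - c l, ci - c l⟫ := by
    intro t ht0 ht1
    have hmem : (1 - t) • l + t • Pi.single i (1 : ℝ) ∈ stdSimplex ℝ ι :=
      convex_stdSimplex ℝ ι hl (single_mem_stdSimplex ℝ i) (by linarith) ht0.le (by ring)
    have hcl : c ((1 - t) • l + t • Pi.single i (1 : ℝ)) = c l + t • (ci - c l) := by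
      have : c ((1 - t) • l + t • Pi.single i (1 : ℝ)) = (1 - t) • c l + t • ci := by
        simp [c, hci, add_smul, Finset.sum_add_distrib, mul_smul, Finset.smul_sum,
          Pi.single_apply, ite_smul]
      rw [this]
      module
    have hsl : s ((1 - t) • l + t • Pi.single i (1 : ℝ)) = (1 - t) * s l + t * ⟪g i, v i⟫ := by
      simp [s, add_mul, Finset.sum_add_distrib, mul_assoc, Finset.mul_sum, Pi.single_apply]
    have h := hmax hmem
    simp only [Set.mem_ofPred_eq, hcl, hsl] at h
    rw [inner_add_left, inner_add_right, inner_add_right, real_inner_smul_left,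
      real_inner_smul_left, real_inner_smul_right, real_inner_smul_right,
      real_inner_comm (c l) (ci - c l)] at h
    refine le_of_mul_le_mul_left ?_ ht0
    linarith
  have hder : -2 * ⟪c l, ci - c l⟫ - ⟪g i, v i⟫ + s l ≤ 0 := by
    refine ge_of_tendsto (x := nhdsWithin (0 : ℝ) (Set.Ioi 0))
      (f := fun t : ℝ => t * ⟪ci - c l, ci - c l⟫) ?_ ?_
    · have : Continuous fun t : ℝ => t * ⟪ci - c l, ci - c l⟫ := by fun_prop
      simpa using (this.tendsto 0).mono_left nhdsWithin_le_nhds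
    · filter_upwards [Ioc_mem_nhdsGT (zero_lt_one' ℝ)] with t ht using hdir t ht.1 ht.2
  have hexp : ⟪c l + g i, c l - v i⟫ = ⟪c l, c l⟫ - 2 * ⟪c l, ci⟫ - ⟪g i, v i⟫ := by
    simp only [hci, inner_add_left, inner_sub_right, real_inner_smul_right]
    rw [real_inner_comm (c l) (g i)]
    ring
  rw [inner_sub_right] at hder
  linarith

/-- Debrunner–Flor for an arbitrary monotone family in finite dimension. -/
lemma exists_inner_add_sub_nonpos_of_monotone_of_finiteDimensional [FiniteDimensional ℝ E]
    {ι : Type*} [Nonempty ι] {g v : ι → E} (hmono : ∀ i j, 0 ≤ ⟪g i - g j, v i - v j⟫) :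
    ∃ x, ∀ i, ⟪x + g i, x - v i⟫ ≤ 0 := by
  classical
  have := FiniteDimensional.proper ℝ E
  let B : ι → Set E := fun i => {x | ⟪x + g i, x - v i⟫ ≤ 0}
  have hclosed : ∀ i, IsClosed (B i) := fun i => isClosed_le (by fun_prop) continuous_const
  let i₀ : ι := Classical.arbitrary ι
  have hcompact : IsCompact (B i₀) := by
    refine Metric.isCompact_of_isClosed_isBounded (hclosed i₀)
      ((Metric.isBounded_closedBall (x := (0 : E)) (r := ‖v i₀‖ + 2 * ‖g i₀‖)).subset fun x hx => ?_)
    have hx' : ⟪x + g i₀, x - v i₀⟫ ≤ 0 := hx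
    rw [inner_add_left, inner_sub_right, inner_sub_right, real_inner_self_eq_norm_sq] at hx'
    have h1 := real_inner_le_norm x (v i₀)
    have h2 := real_inner_le_norm (g i₀) (v i₀)
    have h3 := neg_le_of_abs_le (abs_real_inner_le_norm (g i₀) x)
    rw [mem_closedBall_zero_iff]
    by_contra! hlt
    have hv := norm_nonneg (v i₀)
    have hg := norm_nonneg (g i₀)
    have h4 : 0 < ‖x‖ * (‖x‖ - (‖v i₀‖ + 2 * ‖g i₀‖)) :=
      mul_pos (by linarith) (by linarith)
    have h5 : ‖g i₀‖ * ‖v i₀‖ ≤ ‖g i₀‖ * ‖x‖ := mul_le_mul_of_nonneg_left (by linarith) hg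
    nlinarith
  obtain ⟨x, -, hx⟩ := hcompact.inter_iInter_nonempty B hclosed fun u => by
    have : Nonempty {i // i ∈ insert i₀ u} := ⟨⟨i₀, Finset.mem_insert_self _ _⟩⟩
    obtain ⟨x, hx⟩ := exists_inner_add_sub_nonpos_of_monotone
      (g := fun i : {i // i ∈ insert i₀ u} => g i) (v := fun i => v i) fun i j => hmono i j
    exact ⟨x, hx ⟨i₀, Finset.mem_insert_self _ _⟩, Set.mem_iInter₂.2 fun i hi =>
      hx ⟨i, Finset.mem_insert_of_mem hi⟩⟩
  exact ⟨x, fun i => Set.mem_iInter.1 hx i⟩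

end MonotoneSets

/-- Minty's theorem: `x + k f(x) ∋ z` is solvable for maximal monotone `f` and `k > 0`. -/
lemma MaxMonotone.exists_resolvent {d : ℕ}
    {f : EuclideanSpace ℝ (Fin d) → Set (EuclideanSpace ℝ (Fin d))} (hf : MaxMonotone f)
    {k : ℝ} (hk : 0 < k) (z : EuclideanSpace ℝ (Fin d)) : ∃ x, k⁻¹ • (z - x) ∈ f x := by
  let ι := {q : EuclideanSpace ℝ (Fin d) × EuclideanSpace ℝ (Fin d) // q.2 ∈ f q.1}
  have : Nonempty ι := by
    by_contra hempty
    exact hempty ⟨(0, 0), hf.2 0 0 fun v fv hv => (hempty ⟨(v, fv), hv⟩).elim⟩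
  obtain ⟨x, hx⟩ := exists_inner_add_sub_nonpos_of_monotone_of_finiteDimensional
    (g := fun q : ι => k • q.1.2 - z) (v := fun q => q.1.1) fun q r => by
      rw [sub_sub_sub_cancel_right, ← smul_sub, real_inner_smul_left]
      exact mul_nonneg hk.le (hf.1 _ _ _ _ q.2 r.2)
  refine ⟨x, hf.2 _ _ fun v fv hv => ?_⟩
  have h : ⟪x + (k • fv - z), x - v⟫ ≤ 0 := hx ⟨(v, fv), hv⟩
  have heq : k⁻¹ • (z - x) - fv = (-k⁻¹) • (x + (k • fv - z)) := by
    have : fv = k⁻¹ • k • fv := (inv_smul_smul₀ hk.ne' fv).symm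
    nth_rewrite 1 [this]
    module
  rw [heq, real_inner_smul_left]
  exact mul_nonneg_of_nonpos_of_nonpos (neg_nonpos.2 (inv_nonneg.2 hk.le)) h

/-- Resolvents of a monotone map are nonexpansive. -/
lemma MaxMonotone.norm_sub_le_of_resolvent {d : ℕ}
    {f : EuclideanSpace ℝ (Fin d) → Set (EuclideanSpace ℝ (Fin d))} (hf : MaxMonotone f)
    {k : ℝ} (hk : 0 ≤ k) {x y η ξ : EuclideanSpace ℝ (Fin d)} (hη : η ∈ f x) (hξ : ξ ∈ f y) :
    ‖x - y‖ ≤ ‖(x + k • η) - (y + k • ξ)‖ := by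
  have h : ⟪x - y, x - y⟫ ≤ ⟪(x + k • η) - (y + k • ξ), x - y⟫ := by
    rw [add_sub_add_comm, ← smul_sub, inner_add_left, real_inner_smul_left]
    exact le_add_of_nonneg_right (mul_nonneg hk (hf.1 _ _ _ _ hη hξ))
  have h' := h.trans (real_inner_le_norm _ _)
  rw [real_inner_self_eq_norm_mul_norm] at h'
  by_contra! hlt
  exact absurd h' (not_le.2 (mul_lt_mul_of_pos_right hlt ((norm_nonneg _).trans_lt hlt)))

/-- Unique solvability of the nonlinear inclusion
`x₀ + k·f(x₀) − k·b(x₀) ∋ w` defining one step of the backward Euler method. -/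
theorem stmt8 {d : ℕ} (T : ℝ) (hT : 0 < T)
    (f : EuclideanSpace ℝ (Fin d) → Set (EuclideanSpace ℝ (Fin d)))
    (β lam μ p : ℝ) (hβ : 0 ≤ β) (hlam : 0 ≤ lam) (hμ : 0 < μ) (hp : 1 ≤ p)
    (hf : AssumptionF f β lam μ p)
    (b : EuclideanSpace ℝ (Fin d) → EuclideanSpace ℝ (Fin d))
    (Lb : ℝ≥0) (hb : LipschitzWith Lb b)
    (w : EuclideanSpace ℝ (Fin d)) (k : ℝ) (hk0 : 0 < k) (hkT : k ≤ T)
    (hkb : (Lb : ℝ) * k < 1) :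
    ∃ x₀ η, η ∈ f x₀ ∧ x₀ + k • η - k • b x₀ = w ∧
      ∀ x₀' η', η' ∈ f x₀' → x₀' + k • η' - k • b x₀' = w → x₀' = x₀ ∧ η' = η := by
  have hmono := hf.1
  choose J hJ using fun z => hmono.exists_resolvent hk0 z
  have hJz : ∀ z, J z + k • (k⁻¹ • (z - J z)) = z := fun z => by
    rw [smul_inv_smul₀ hk0.ne', add_sub_cancel]
  have hbk : ∀ x y, ‖k • b x - k • b y‖ ≤ (Lb * k) * ‖x - y‖ := fun x y => by
    rw [← smul_sub, norm_smul, Real.norm_of_nonneg hk0.le, mul_comm (Lb : ℝ), mul_assoc]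
    exact mul_le_mul_of_nonneg_left (hb.norm_sub_le x y) hk0.le
  have hcontr : ContractingWith (Lb * ⟨k, hk0.le⟩) fun x => J (w + k • b x) := by
    refine ⟨by exact_mod_cast hkb, LipschitzWith.of_dist_le_mul fun x y => ?_⟩
    rw [dist_eq_norm, dist_eq_norm]
    have h := hmono.norm_sub_le_of_resolvent hk0.le (hJ (w + k • b x)) (hJ (w + k • b y))
    rw [hJz, hJz, add_sub_add_left_eq_sub] at h
    exact h.trans (hbk x y)
  obtain ⟨x₀, hx₀⟩ : ∃ x, J (w + k • b x) = x := ⟨_, hcontr.fixedPoint_isFixedPt⟩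
  have hη := hJ (w + k • b x₀)
  have hsol := hJz (w + k • b x₀)
  rw [hx₀] at hη hsol
  refine ⟨x₀, _, hη, sub_eq_iff_eq_add.2 hsol, fun x₀' η' hη' hsol' => ?_⟩
  have hx : x₀' = x₀ := by
    have h := hmono.norm_sub_le_of_resolvent hk0.le hη' hη
    rw [hsol, sub_eq_iff_eq_add.1 hsol', add_sub_add_left_eq_sub] at h
    have h' := h.trans (hbk x₀' x₀)
    by_contra hne
    have hpos : 0 < ‖x₀' - x₀‖ := norm_pos_iff.2 (sub_ne_zero.2 hne)
    nlinarith
  subst hx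
  refine ⟨rfl, smul_right_injective _ hk0.ne' (add_left_cancel (a := x₀') ?_)⟩
  exact (sub_eq_iff_eq_add.1 hsol').trans hsol.symm
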